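/- arXiv:0905.1185 — 3 statements merged into one kernel-verified Lean document; each statement's English description precedes it below -/
import Mathlib

section
/- Let k be a field, let G and G' be finite groups, and let E : Rep k G ≌ Rep k G' be an equivalence of categories whose underlying functor is k-linear (additive and k-linear) and monoidal. Then E.functor applied to the left regular representation of G (the representation of G on the free k-module k[G] induced by left multiplication of G on itself) is isomorphic in Rep k G' to the left regular representation of G'. -/
open CategoryTheory
open MonoidalCategory
open scoped MonoidAlgebra TensorProduct

section HomDimension

variable {k A : Type} [Field k] [Ring A] [Algebra k A]

section

variable {X M N P : Type}
  [AddCommGroup X] [Module A X]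
  [AddCommGroup M] [Module k M] [Module A M] [IsScalarTower k A M]
  [AddCommGroup N] [Module k N] [Module A N] [IsScalarTower k A N]
  [AddCommGroup P] [Module A P]

theorem finite_linearMap_of_algebra [Module k X] [IsScalarTower k A X] [Module.Finite k X]
    [Module.Finite k M] :
    Module.Finite k (X →ₗ[A] M) :=
  Module.Finite.of_injective (LinearMap.restrictScalarsₗ k A X M k)
    (LinearMap.restrictScalars_injective k)

theorem finite_submodule_of_algebra [Module.Finite k M] (p : Submodule A M) : Module.Finite k p :=
  Module.Finite.of_injective (p.subtype.restrictScalars k) p.injective_subtype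

theorem finrank_linearMap_congr_right (e : M ≃ₗ[A] N) :
    Module.finrank k (X →ₗ[A] M) = Module.finrank k (X →ₗ[A] N) :=
  LinearEquiv.finrank_eq
    { toFun := fun f => e.toLinearMap ∘ₗ f
      invFun := fun f => e.symm.toLinearMap ∘ₗ f
      map_add' := fun f g => by ext; simp
      map_smul' := fun c f => by
        ext x
        exact (e.toLinearMap.restrictScalars k).map_smul c (f x)
      left_inv := fun f => by ext; simp
      right_inv := fun f => by ext; simp }

theorem finrank_linearMap_congr_left (e : X ≃ₗ[A] P) :
    Module.finrank k (X →ₗ[A] M) = Module.finrank k (P →ₗ[A] M) :=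
  LinearEquiv.finrank_eq
    { toFun := fun f => f ∘ₗ e.symm.toLinearMap
      invFun := fun f => f ∘ₗ e.toLinearMap
      map_add' := fun f g => by ext; simp
      map_smul' := fun c f => by ext; simp
      left_inv := fun f => by ext; simp
      right_inv := fun f => by ext; simp }

theorem finrank_linearMap_of_isCompl [Module k X] [IsScalarTower k A X] [Module.Finite k X]
    [Module.Finite k M]
    {p q : Submodule A M} (h : IsCompl p q) :
    Module.finrank k (X →ₗ[A] M) =
      Module.finrank k (X →ₗ[A] p) + Module.finrank k (X →ₗ[A] q) := by
  have := finite_submodule_of_algebra (k := k) p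
  have := finite_submodule_of_algebra (k := k) q
  have := finite_linearMap_of_algebra (k := k) (A := A) (X := X) (M := p)
  have := finite_linearMap_of_algebra (k := k) (A := A) (X := X) (M := q)
  rw [← finrank_linearMap_congr_right (Submodule.prodEquivOfIsCompl p q h),
    ← (LinearMap.prodEquiv k : ((X →ₗ[A] p) × (X →ₗ[A] q)) ≃ₗ[k] _).finrank_eq,
    Module.finrank_prod]

/-- Restriction along a cokernel: maps out of `N ⧸ range f` are the maps killed by `f`. -/
theorem finrank_linearMap_quotient_range_add [Module k P] [IsScalarTower k A P]
    [Module.Finite k P] [Module.Finite k M]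
    (f : X →ₗ[A] P) :
    Module.finrank k (P ⧸ LinearMap.range f →ₗ[A] M) +
      Module.finrank k (LinearMap.range (LinearMap.lcomp k M f)) =
      Module.finrank k (P →ₗ[A] M) := by
  have := finite_linearMap_of_algebra (k := k) (A := A) (X := P) (M := M)
  have hinj : Function.Injective (LinearMap.lcomp k M (LinearMap.range f).mkQ) := fun a b hab =>
    LinearMap.cancel_right (Submodule.mkQ_surjective _) |>.mp hab
  have hrange : LinearMap.range (LinearMap.lcomp k M (LinearMap.range f).mkQ) =
      LinearMap.ker (LinearMap.lcomp k M f) := by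
    ext a
    rw [LinearMap.mem_ker, LinearMap.mem_range]
    constructor
    · rintro ⟨b, rfl⟩
      ext x
      have hx : (LinearMap.range f).mkQ (f x) = 0 := by simp
      change b ((LinearMap.range f).mkQ (f x)) = 0
      rw [hx, map_zero]
    · intro ha
      refine ⟨(LinearMap.range f).liftQ a ?_, by ext; rfl⟩
      rintro _ ⟨x, rfl⟩
      exact LinearMap.congr_fun ha x
  rw [← (LinearMap.lcomp k M f).finrank_range_add_finrank_ker, add_comm, ← hrange,
    LinearMap.finrank_range_of_inj hinj]

/-- If `M` is a nonzero direct summand of a power of `N`, then some composite `M → N → M` is not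
nilpotent. -/
theorem exists_not_isNilpotent_comp_of_retract [Nontrivial M] {n : ℕ} (f : M →ₗ[A] (Fin n → N))
    (g : (Fin n → N) →ₗ[A] M) (hgf : g ∘ₗ f = LinearMap.id) :
    ∃ (u : M →ₗ[A] N) (v : N →ₗ[A] M), ¬ IsNilpotent (v ∘ₗ u : Module.End A M) := by
  by_contra! H
  have key (u : M →ₗ[A] N) (v : N →ₗ[A] M) :
      (v ∘ₗ u : Module.End A M) ∈ Ideal.jacobson (⊥ : Ideal (Module.End A M)) := by
    rw [Ideal.mem_jacobson_iff]
    intro y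
    obtain ⟨z, hz⟩ := (IsNilpotent.isUnit_add_one (H u (y ∘ₗ v))).exists_left_inv
    refine ⟨z, ?_⟩
    rw [Ideal.mem_bot, ← hz, mul_add, mul_one, mul_assoc]
    exact sub_self _
  have h1 : (1 : Module.End A M) ∈ Ideal.jacobson (⊥ : Ideal (Module.End A M)) := by
    have : (1 : Module.End A M) =
        ∑ i, (g ∘ₗ LinearMap.single A (fun _ => N) i) ∘ₗ (LinearMap.proj i ∘ₗ f) := by
      refine LinearMap.ext fun x => ?_
      rw [LinearMap.sum_apply]
      have := LinearMap.congr_fun hgf x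
      simp only [LinearMap.comp_apply, LinearMap.proj_apply, Module.End.one_apply] at this ⊢
      rw [← map_sum]
      simp only [LinearMap.single_apply, Finset.univ_sum_single]
      exact this.symm
    rw [this]
    exact Ideal.sum_mem _ fun i _ => key _ _
  rw [← Ideal.eq_top_iff_one, Ideal.jacobson_eq_top_iff] at h1
  exact bot_ne_top h1

theorem exists_injective_range_pow (u : M →ₗ[A] N) (v : N →ₗ[A] M) {n : ℕ} (hn : n ≠ 0)
    (h : Disjoint (LinearMap.ker ((v ∘ₗ u : Module.End A M) ^ n))
      (LinearMap.range ((v ∘ₗ u : Module.End A M) ^ n))) :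
    ∃ w : LinearMap.range ((v ∘ₗ u : Module.End A M) ^ n) →ₗ[A]
      LinearMap.range ((u ∘ₗ v : Module.End A N) ^ n), Function.Injective w := by
  have hcomm (x : M) : u (((v ∘ₗ u : Module.End A M) ^ n) x) =
      ((u ∘ₗ v : Module.End A N) ^ n) (u x) := by
    have := Module.End.commute_pow_left_of_commute (f := u) (g := (v ∘ₗ u : Module.End A M))
      (g₂ := (u ∘ₗ v : Module.End A N)) rfl n
    exact (LinearMap.congr_fun this x).symm
  refine ⟨u.restrict ?_, ?_⟩
  · rintro _ ⟨x, rfl⟩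
    exact ⟨u x, (hcomm x).symm⟩
  · rw [← LinearMap.ker_eq_bot, LinearMap.ker_eq_bot']
    rintro ⟨x, hx⟩ hux
    replace hux : u x = 0 := congrArg Subtype.val hux
    have : x ∈ LinearMap.ker ((v ∘ₗ u : Module.End A M) ^ n) := by
      obtain ⟨m, rfl⟩ := Nat.exists_eq_succ_of_ne_zero hn
      rw [LinearMap.mem_ker, pow_succ, Module.End.mul_apply, LinearMap.comp_apply, hux]
      simp
    exact Subtype.ext (Submodule.disjoint_def.mp h x this hx)

theorem nonempty_linearEquiv_of_injective [Module.Finite k M] [Module.Finite k N]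
    (a : M →ₗ[A] N) (b : N →ₗ[A] M) (ha : Function.Injective a) (hb : Function.Injective b) :
    Nonempty (M ≃ₗ[A] N) :=
  ⟨LinearEquiv.ofBijective a ⟨ha,
    (LinearMap.injective_iff_surjective_of_finrank_eq_finrank (f := a.restrictScalars k)
      ((LinearMap.finrank_le_finrank_of_injective (f := a.restrictScalars k) ha).antisymm
        (LinearMap.finrank_le_finrank_of_injective (f := b.restrictScalars k) hb))).mp ha⟩⟩

/-- Fitting's lemma for a pair of maps: a non-nilpotent composite `M → N → M` splits off a common
nonzero direct summand of `M` and `N`. -/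
theorem exists_common_summand [Module.Finite k M] [Module.Finite k N]
    (u : M →ₗ[A] N) (v : N →ₗ[A] M) (h : ¬ IsNilpotent (v ∘ₗ u : Module.End A M)) :
    ∃ (p p' : Submodule A M) (q q' : Submodule A N), IsCompl p p' ∧ IsCompl q q' ∧ p ≠ ⊥ ∧
      Nonempty (p ≃ₗ[A] q) := by
  have : IsNoetherian A M := isNoetherian_of_tower k inferInstance
  have : IsNoetherian A N := isNoetherian_of_tower k inferInstance
  have : IsArtinian A M := isArtinian_of_tower k inferInstance
  have : IsArtinian A N := isArtinian_of_tower k inferInstance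
  obtain ⟨n, ⟨hM, hN⟩, hn⟩ :=
    (((v ∘ₗ u : Module.End A M).eventually_isCompl_ker_pow_range_pow.and
      (u ∘ₗ v : Module.End A N).eventually_isCompl_ker_pow_range_pow).and
      (Filter.eventually_ne_atTop 0)).exists
  refine ⟨_, _, _, _, hM.symm, hN.symm, fun h0 => h ⟨n, LinearMap.range_eq_bot.mp h0⟩, ?_⟩
  obtain ⟨a, ha⟩ := exists_injective_range_pow u v hn hM.disjoint
  obtain ⟨b, hb⟩ := exists_injective_range_pow v u hn hN.disjoint
  have := finite_submodule_of_algebra (k := k) (LinearMap.range ((v ∘ₗ u : Module.End A M) ^ n))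
  have := finite_submodule_of_algebra (k := k) (LinearMap.range ((u ∘ₗ v : Module.End A N) ^ n))
  exact nonempty_linearEquiv_of_injective (k := k) a b ha hb

theorem finite_quotient_of_algebra [Module.Finite k M] (p : Submodule A M) :
    Module.Finite k (M ⧸ p) :=
  Module.Finite.of_surjective (p.mkQ.restrictScalars k) p.mkQ_surjective

variable (k) in
/-- If `M` and `N` have the same number of maps from every finite-dimensional module, then `M` is
a direct summand of a power of `N`. -/
theorem exists_retract_of_finrank_linearMap_eq [Module.Finite k M] [Module.Finite k N]
    (h : ∀ (X : Type) [AddCommGroup X] [Module k X] [Module A X] [IsScalarTower k A X]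
      [Module.Finite k X], Module.finrank k (X →ₗ[A] M) = Module.finrank k (X →ₗ[A] N)) :
    ∃ (n : ℕ) (f : M →ₗ[A] (Fin n → N)) (g : (Fin n → N) →ₗ[A] M), g ∘ₗ f = LinearMap.id := by
  have := finite_linearMap_of_algebra (k := k) (A := A) (X := M) (M := M)
  have := finite_linearMap_of_algebra (k := k) (A := A) (X := M) (M := N)
  let b := Module.finBasis k (M →ₗ[A] N)
  let f : M →ₗ[A] (Fin (Module.finrank k (M →ₗ[A] N)) → N) := LinearMap.pi b
  have := finite_quotient_of_algebra (k := k) (LinearMap.range f)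
  have hN : LinearMap.range (LinearMap.lcomp k N f) = ⊤ := by
    rw [eq_top_iff, ← b.span_eq, Submodule.span_le]
    rintro _ ⟨i, rfl⟩
    exact ⟨LinearMap.proj i, by ext; rfl⟩
  have eN := finrank_linearMap_quotient_range_add (k := k) (M := N) f
  have eM := finrank_linearMap_quotient_range_add (k := k) (M := M) f
  have hM : LinearMap.range (LinearMap.lcomp k M f) = ⊤ := by
    apply Submodule.eq_top_of_finrank_eq
    have h₁ := h (_ ⧸ LinearMap.range f)
    have h₂ := h (Fin (Module.finrank k (M →ₗ[A] N)) → N)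
    have h₃ := h M
    rw [hN, finrank_top] at eN
    omega
  obtain ⟨g, hg⟩ := LinearMap.range_eq_top.mp hM LinearMap.id
  exact ⟨_, f, g, hg⟩

variable (k) in
/-- Bongartz's theorem: a finite-dimensional module over an algebra is determined up to
isomorphism by the dimensions of the spaces of maps into it. -/
theorem nonempty_linearEquiv_of_finrank_linearMap_eq [Module.Finite k M] [Module.Finite k N]
    (h : ∀ (X : Type) [AddCommGroup X] [Module k X] [Module A X] [IsScalarTower k A X]
      [Module.Finite k X], Module.finrank k (X →ₗ[A] M) = Module.finrank k (X →ₗ[A] N)) :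
    Nonempty (M ≃ₗ[A] N) := by
  induction hd : Module.finrank k M using Nat.strong_induction_on generalizing M N with
  | _ d ih =>
  have := finite_linearMap_of_algebra (k := k) (A := A) (X := N) (M := N)
  rcases subsingleton_or_nontrivial M with hM | hM
  · have h0 : Subsingleton (N →ₗ[A] N) := by
      rw [← Module.finrank_zero_iff (R := k), ← h N]
      exact Module.finrank_zero_of_subsingleton
    have : Subsingleton N := ⟨fun x y => by
      rw [← LinearMap.id_apply (R := A) x, ← LinearMap.id_apply (R := A) y,
        Subsingleton.elim LinearMap.id (0 : N →ₗ[A] N)]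
      rfl⟩
    exact ⟨0⟩
  obtain ⟨n, f, g, hgf⟩ := exists_retract_of_finrank_linearMap_eq k h
  obtain ⟨u, v, huv⟩ := exists_not_isNilpotent_comp_of_retract f g hgf
  obtain ⟨p, p', q, q', hp, hq, hp0, ⟨e⟩⟩ := exists_common_summand (k := k) u v huv
  have := finite_submodule_of_algebra (k := k) p
  have := finite_submodule_of_algebra (k := k) p'
  have := finite_submodule_of_algebra (k := k) q'
  have hlt : Module.finrank k p' < d := by
    have h1 := ((Submodule.prodEquivOfIsCompl p p' hp).restrictScalars k).finrank_eq
    rw [Module.finrank_prod] at h1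
    have : Nontrivial p := Submodule.nontrivial_iff_ne_bot.mpr hp0
    have := Module.finrank_pos (R := k) (M := p)
    omega
  obtain ⟨e'⟩ := ih _ hlt (M := p') (N := q') (fun X _ _ _ _ _ => by
    have h1 := h X
    rw [finrank_linearMap_of_isCompl hp, finrank_linearMap_of_isCompl hq,
      finrank_linearMap_congr_right e] at h1
    omega) rfl
  exact ⟨(Submodule.prodEquivOfIsCompl p p' hp).symm ≪≫ₗ e.prodCongr e' ≪≫ₗ
    Submodule.prodEquivOfIsCompl q q' hq⟩

end

end HomDimension

namespace Rep

variable {k G G' : Type} [Field k] [Group G] [Group G']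

/-- Maps into the regular representation of a finite group correspond to linear functionals, by
taking the coefficient at `1`. -/
noncomputable def homLeftRegularEquiv [Finite G] (X : Rep.{0} k G) :
    (X ⟶ leftRegular k G) ≃ₗ[k] Module.Dual k X where
  toFun f :=
    { toFun := fun x => (f.hom x).coeff 1
      map_add' := fun x y => by simp
      map_smul' := fun c x => by simp }
  map_add' f g := rfl
  map_smul' c f := rfl
  invFun φ := ofHom
    ⟨{ toFun := fun x => .ofCoeff (Finsupp.equivFunOnFinite.symm fun g => φ (X.ρ g⁻¹ x))
       map_add' := fun x y => by ext; simp
       map_smul' := fun c x => by ext; simp }, fun g => by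
        ext x h
        simp [Representation.coeff_ofMulAction]⟩
  left_inv f := by
    ext x h
    have := hom_comm_apply f h⁻¹ x
    simp [this, Representation.coeff_ofMulAction]
  right_inv φ := by
    ext x
    simp

theorem coeff_homLeftRegularEquiv_symm_apply [Finite G] (X : Rep.{0} k G) (φ : Module.Dual k X)
    (x : X) (g : G) :
    (((homLeftRegularEquiv X).symm φ).hom x).coeff g = φ (X.ρ g⁻¹ x) :=
  rfl

theorem hom_ext_single_one {X : Rep.{0} k G} {f g : leftRegular k G ⟶ X}
    (h : f.hom (MonoidAlgebra.single 1 1 : k[G]) = g.hom (MonoidAlgebra.single 1 1 : k[G])) :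
    f = g :=
  (leftRegularHomEquiv X).injective <| by simpa [homEquiv] using h

/-- `X ⊗ k[G]` is a direct sum of `dim X` copies of `k[G]`. -/
theorem exists_tensor_leftRegular_decomposition [Finite G] (X : Rep.{0} k G) [Module.Finite k X] :
    ∃ (i : Fin (Module.finrank k X) → (leftRegular k G ⟶ X ⊗ leftRegular k G))
      (p : Fin (Module.finrank k X) → (X ⊗ leftRegular k G ⟶ leftRegular k G)),
      (∀ a b, i a ≫ p b = if a = b then 𝟙 _ else 0) ∧ ∑ a, p a ≫ i a = 𝟙 _ := by
  let b := Module.finBasis k X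
  let ev : k[G] →ₗ[k] k := Finsupp.lapply 1 ∘ₗ (MonoidAlgebra.coeffLinearEquiv k).toLinearMap
  let φ (a) : Module.Dual k (X ⊗ leftRegular k G : Rep k G) :=
    LinearMap.mul' k k ∘ₗ TensorProduct.map (b.coord a) ev
  let i (a) : leftRegular k G ⟶ X ⊗ leftRegular k G :=
    leftRegularHom (X ⊗ leftRegular k G) (b a ⊗ₜ[k] (MonoidAlgebra.single 1 1 : k[G]))
  let p (a) : X ⊗ leftRegular k G ⟶ leftRegular k G := (homLeftRegularEquiv _).symm (φ a)
  have hi (a) : (i a).hom (MonoidAlgebra.single 1 1 : k[G]) =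
      b a ⊗ₜ[k] (MonoidAlgebra.single 1 1 : k[G]) := by
    rw [leftRegularHom_hom_single]
    simp
  have hp (a) (x : X) : (p a).hom (x ⊗ₜ[k] (MonoidAlgebra.single 1 1 : k[G])) =
      (MonoidAlgebra.single 1 (b.coord a x) : k[G]) := by
    classical
    ext g
    rw [coeff_homLeftRegularEquiv_symm_apply]
    by_cases hg : g = 1
    · subst hg
      simp [φ, ev]
    · simp [φ, ev, hg]
  refine ⟨i, p, fun a c => ?_, ?_⟩
  · apply hom_ext_single_one
    change (p c).hom ((i a).hom (MonoidAlgebra.single 1 1 : k[G])) = _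
    rw [hi, hp]
    split_ifs with h
    · simp [h]
    · simp [h]
  · have key (x : X) (g : G) : (∑ a, p a ≫ i a).hom (x ⊗ₜ[k] (MonoidAlgebra.single g 1 : k[G])) =
        x ⊗ₜ[k] (MonoidAlgebra.single g 1 : k[G]) := by
      have h1 (y : X) : (∑ a, p a ≫ i a).hom (y ⊗ₜ[k] (MonoidAlgebra.single 1 1 : k[G])) =
          y ⊗ₜ[k] (MonoidAlgebra.single 1 1 : k[G]) := by
        have hs (a) : (MonoidAlgebra.single 1 (b.coord a y) : k[G]) =
            b.coord a y • (MonoidAlgebra.single 1 1 : k[G]) := by simp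
        rw [sum_hom, Representation.IntertwiningMap.sum_apply]
        simp only [hom_comp, Representation.IntertwiningMap.comp_apply, hp, hs, map_smul, hi]
        have hb : (∑ a, b.coord a y • (b a ⊗ₜ[k] (MonoidAlgebra.single 1 1 : k[G])) :
            X ⊗[k] k[G]) = y ⊗ₜ[k] (MonoidAlgebra.single 1 1 : k[G]) := by
          simp_rw [TensorProduct.smul_tmul', ← TensorProduct.sum_tmul, b.coord_apply, b.sum_repr]
        exact hb
      have hg := hom_comm_apply (∑ a, p a ≫ i a) g
        (X.ρ g⁻¹ x ⊗ₜ[k] (MonoidAlgebra.single 1 1 : k[G]))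
      rw [h1] at hg
      simpa using hg
    have hlin : (∑ a, p a ≫ i a).hom.toLinearMap =
        (LinearMap.id : X ⊗[k] k[G] →ₗ[k] X ⊗[k] k[G]) := by
      refine TensorProduct.ext' fun x f => ?_
      induction f using MonoidAlgebra.induction_linear with
      | zero => simp
      | add f g hf hg => rw [TensorProduct.tmul_add, map_add, hf, hg, map_add]
      | single g r =>
        have hr : (MonoidAlgebra.single g r : k[G]) = r • MonoidAlgebra.single g 1 := by simp
        rw [hr, TensorProduct.tmul_smul, map_smul, map_smul]
        exact congrArg (r • ·) (key x g)
    ext x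
    exact LinearMap.congr_fun hlin x

theorem finrank_eq_mul_of_decomposition {n : ℕ} {P Z : Rep.{0} k G} [Module.Finite k P]
    (i : Fin n → (P ⟶ Z)) (p : Fin n → (Z ⟶ P))
    (hip : ∀ a b, i a ≫ p b = if a = b then 𝟙 _ else 0) (hpi : ∑ a, p a ≫ i a = 𝟙 _) :
    Module.finrank k Z = n * Module.finrank k P := by
  have h₁ (a b) (x : P) : (p b).hom ((i a).hom x) = if a = b then x else 0 := by
    have := congrArg (fun f => f.hom x) (hip a b)
    simp only [hom_comp] at this
    rw [← Representation.IntertwiningMap.comp_apply, this]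
    split_ifs <;> rfl
  have h₂ (z : Z) : ∑ a, (i a).hom ((p a).hom z) = z := by
    have := congrArg (fun f => f.hom z) hpi
    simpa [sum_hom, Representation.IntertwiningMap.sum_apply] using this
  let e : Z ≃ₗ[k] (Fin n → P) :=
    { toLinearMap := LinearMap.pi fun a => (p a).hom.toLinearMap
      invFun := fun f => ∑ a, (i a).hom (f a)
      left_inv := fun z => h₂ z
      right_inv := fun f => by
        ext b
        change (p b).hom (∑ a, (i a).hom (f a)) = f b
        simp [map_sum, h₁] }
  rw [e.finrank_eq, Module.finrank_pi_fintype]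
  simp

/-- A family of maps with common target is jointly epimorphic if and only if the images span. -/
theorem iSup_range_eq_top_iff {ι : Type*} {Q : Rep.{0} k G} {X : Rep.{0} k G} (f : ι → (Q ⟶ X)) :
    ⨆ a, LinearMap.range (f a).hom.toLinearMap = ⊤ ↔
      ∀ (Y : Rep.{0} k G) (c : X ⟶ Y), (∀ a, f a ≫ c = 0) → c = 0 := by
  constructor
  · intro h Y c hc
    have : (⊤ : Submodule k X) ≤ LinearMap.ker c.hom.toLinearMap := by
      rw [← h, iSup_le_iff]
      rintro a _ ⟨x, rfl⟩
      exact congrArg (fun d => d.hom x) (hc a)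
    ext x
    exact this (Submodule.mem_top (x := x))
  · intro h
    have hW (g : G) : ⨆ a, LinearMap.range (f a).hom.toLinearMap ≤
        (⨆ a, LinearMap.range (f a).hom.toLinearMap).comap (X.ρ g) := by
      rw [iSup_le_iff]
      rintro a _ ⟨x, rfl⟩
      exact Submodule.mem_iSup_of_mem a ⟨Q.ρ g x, hom_comm_apply (f a) g x⟩
    have h0 := h _ (mkQ X _ hW) (fun a => by
      ext x
      exact (Submodule.Quotient.mk_eq_zero _).mpr (Submodule.mem_iSup_of_mem a ⟨x, rfl⟩))
    rw [eq_top_iff]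
    intro x _
    exact (Submodule.Quotient.mk_eq_zero _).mp (congrArg (fun d => d.hom x) h0)

/-- The preimage of the regular representation under an equivalence is a separator. -/
theorem eq_zero_of_forall_comp_eq_zero (F : Rep.{0} k G ⥤ Rep.{0} k G') [F.IsEquivalence]
    [F.Additive] {Q : Rep.{0} k G} (e : F.obj Q ≅ leftRegular k G') {X Y : Rep.{0} k G}
    (c : X ⟶ Y) (hc : ∀ h : Q ⟶ X, h ≫ c = 0) : c = 0 := by
  apply F.map_injective
  rw [F.map_zero]
  ext x
  have h := congrArg F.map (hc (F.preimage (e.hom ≫ leftRegularHom (F.obj X) x)))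
  rw [F.map_comp, F.map_preimage, F.map_zero, Category.assoc] at h
  rw [← cancel_epi e.inv, Limits.comp_zero, e.inv_hom_id_assoc] at h
  have := congrArg (fun d => d.hom (MonoidAlgebra.single 1 1 : k[G'])) h
  simpa [leftRegularHom_hom_single] using this

instance [Finite G] : Module.Finite k (leftRegular k G) :=
  inferInstanceAs (Module.Finite k k[G])

/-- Equivalences between categories of representations of finite groups preserve
finite-dimensionality. -/
theorem finite_obj_of_isEquivalence [Finite G'] (F : Rep.{0} k G ⥤ Rep.{0} k G')
    [F.IsEquivalence] [F.Additive] (X : Rep.{0} k G) [Module.Finite k X] :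
    Module.Finite k (F.obj X) := by
  let Q := F.objPreimage (leftRegular k G')
  let e : F.obj Q ≅ leftRegular k G' := F.objObjPreimageIso _
  have htop := (iSup_range_eq_top_iff (fun h : Q ⟶ X => h)).mpr
    fun Y c hc => eq_zero_of_forall_comp_eq_zero F e c hc
  obtain ⟨t, ht⟩ := CompleteLattice.IsCompactElement.exists_finset_of_le_iSup _
    ((Submodule.fg_iff_compact (⊤ : Submodule k X)).mp Module.Finite.fg_top) _ htop.ge
  have ht' : ⨆ a : t, LinearMap.range (a : Q ⟶ X).hom.toLinearMap = ⊤ := by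
    rw [eq_top_iff, iSup_subtype]
    exact ht
  rw [iSup_range_eq_top_iff] at ht'
  have hF : ⨆ a : t, LinearMap.range (e.inv ≫ F.map (a : Q ⟶ X)).hom.toLinearMap = ⊤ := by
    rw [iSup_range_eq_top_iff]
    intro Y c hc
    let u : F.obj (F.objPreimage Y) ≅ Y := F.objObjPreimageIso _
    have h0 := ht' _ (F.preimage (c ≫ u.inv)) fun a => by
      apply F.map_injective
      have h1 := hc a
      rw [Category.assoc, ← cancel_epi e.hom, e.hom_inv_id_assoc, Limits.comp_zero] at h1
      rw [F.map_comp, F.map_preimage, ← Category.assoc, h1, Limits.zero_comp, F.map_zero]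
    have h1 := congrArg F.map h0
    rw [F.map_preimage, F.map_zero, ← cancel_mono u.hom] at h1
    simpa using h1
  rw [Module.finite_def, ← hF]
  exact Submodule.fg_iSup _ fun a => Module.Finite.iff_fg.mp (Module.Finite.range _)

/-- Monoidal additive equivalences between categories of representations of finite groups preserve
dimensions. -/
theorem finrank_obj_of_monoidal [Finite G] [Finite G'] (F : Rep.{0} k G ⥤ Rep.{0} k G')
    [F.IsEquivalence] [F.Additive] [F.Monoidal] (X : Rep.{0} k G) [Module.Finite k X] :
    Module.finrank k (F.obj X) = Module.finrank k X := by
  have hfin := finite_obj_of_isEquivalence F (leftRegular k G)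
  obtain ⟨i, p, hip, hpi⟩ := exists_tensor_leftRegular_decomposition X
  have h₁ := finrank_eq_mul_of_decomposition (fun a => F.map (i a)) (fun a => F.map (p a))
    (fun a b => by
      rw [← F.map_comp, hip]
      split_ifs <;> simp)
    (by simp_rw [← F.map_comp, ← F.map_sum, hpi, F.map_id])
  have h₂ : Module.finrank k (F.obj X ⊗ F.obj (leftRegular k G) : Rep k G') =
      Module.finrank k (F.obj (X ⊗ leftRegular k G)) :=
    (Representation.equivOfIso
      (Functor.Monoidal.μIso F X (leftRegular k G))).toLinearEquiv.finrank_eq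
  have h₃ : Module.finrank k (F.obj X ⊗ F.obj (leftRegular k G) : Rep k G') =
      Module.finrank k (F.obj X) * Module.finrank k (F.obj (leftRegular k G)) :=
    Module.finrank_tensorProduct
  have h₄ : Module.finrank k (F.obj (leftRegular k G)) ≠ 0 := by
    intro h0
    rw [Module.finrank_zero_iff, ← isZero_iff] at h0
    have h1 : Limits.IsZero (leftRegular k G) := by
      rw [Limits.IsZero.iff_id_eq_zero] at h0 ⊢
      apply F.map_injective
      rw [F.map_id, h0, F.map_zero]
    rw [isZero_iff] at h1
    have : Subsingleton k[G] := h1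
    exact one_ne_zero (Subsingleton.elim (1 : k[G]) 0)
  rw [h₃, h₁] at h₂
  exact Nat.eq_of_mul_eq_mul_right (Nat.pos_of_ne_zero h₄) h₂

/-- The image of the regular representation under a linear monoidal equivalence has a
`dim X`-dimensional space of maps from each finite-dimensional `X`. -/
theorem finrank_hom_obj_leftRegular [Finite G] [Finite G'] (F : Rep.{0} k G ⥤ Rep.{0} k G')
    [F.IsEquivalence] [F.Additive] [F.Linear k] [F.Monoidal] (X : Rep.{0} k G')
    [Module.Finite k X] :
    Module.finrank k (X ⟶ F.obj (leftRegular k G)) = Module.finrank k X := by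
  have : F.asEquivalence.functor.Additive := inferInstanceAs F.Additive
  have hinv : F.inv.Additive := F.asEquivalence.inverse_additive
  have hQ : Module.Finite k (F.inv.obj X) := finite_obj_of_isEquivalence F.inv X
  let e : F.obj (F.inv.obj X) ≅ X := F.asEquivalence.counitIso.app X
  have h₁ : Module.finrank k (X ⟶ F.obj (leftRegular k G)) =
      Module.finrank k (F.obj (F.inv.obj X) ⟶ F.obj (leftRegular k G)) :=
    (Linear.homCongr k e.symm (Iso.refl _)).finrank_eq
  have h₂ : Module.finrank k (F.inv.obj X ⟶ leftRegular k G) =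
      Module.finrank k (F.obj (F.inv.obj X) ⟶ F.obj (leftRegular k G)) :=
    (LinearEquiv.ofBijective (F.mapLinearMap k) ⟨F.map_injective, F.map_surjective⟩).finrank_eq
  rw [h₁, ← h₂, (homLeftRegularEquiv _).finrank_eq, Subspace.dual_finrank_eq,
    ← finrank_obj_of_monoidal F, (Representation.equivOfIso e).toLinearEquiv.finrank_eq]

/-- Maps out of a `k[G]`-module, as maps of representations. -/
theorem finrank_linearMap_asModule_eq (X : Type) [AddCommGroup X] [Module k X] [Module k[G] X]
    [IsScalarTower k k[G] X] (Y : Rep.{0} k G) :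
    Module.finrank k (X →ₗ[k[G]] Y.ρ.asModule) =
      Module.finrank k (of (Representation.ofModule' (k := k) (G := G) X) ⟶ Y) := by
  let e : X ≃ₗ[k[G]] (Representation.ofModule' (k := k) (G := G) X).asModule :=
    { (Representation.ofModule' (k := k) (G := G) X).asModuleEquiv.symm.toAddEquiv with
      map_smul' := fun r x => by
        refine (Representation.ofModule' (k := k) (G := G) X).asModuleEquiv.injective ?_
        change r • x = (Representation.ofModule' (k := k) (G := G) X).asAlgebraHom r x
        simp [Representation.ofModule', Representation.asAlgebraHom] }
  rw [finrank_linearMap_congr_left e, (homLinearEquiv _ _).finrank_eq]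
  exact (Representation.IntertwiningMap.equivLinearMapAsModule _ _).finrank_eq.symm

/-- Finite-dimensional representations receiving the same number of maps from every
finite-dimensional representation are isomorphic. -/
theorem nonempty_iso_of_finrank_hom_eq (Y Z : Rep.{0} k G) [Module.Finite k Y] [Module.Finite k Z]
    (h : ∀ X : Rep.{0} k G, Module.Finite k X →
      Module.finrank k (X ⟶ Y) = Module.finrank k (X ⟶ Z)) :
    Nonempty (Y ≅ Z) := by
  have : Module.Finite k Y.ρ.asModule := inferInstanceAs (Module.Finite k Y)
  have : Module.Finite k Z.ρ.asModule := inferInstanceAs (Module.Finite k Z)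
  obtain ⟨e⟩ := nonempty_linearEquiv_of_finrank_linearMap_eq (A := k[G]) k
    (M := Y.ρ.asModule) (N := Z.ρ.asModule) fun X _ _ _ _ _ => by
      rw [finrank_linearMap_asModule_eq, finrank_linearMap_asModule_eq]
      exact h _ ‹_›
  exact ⟨equivalenceModuleMonoidAlgebra.functor.preimageIso e.toModuleIso⟩

end Rep

/-- A `k`-linear monoidal equivalence `Rep k G ≌ Rep k G'` sends the left regular
representation of `G` to (an object isomorphic to) the left regular representation of `G'`. -/
theorem equivalence_obj_leftRegular_iso_leftRegular
    (k : Type) [Field k] (G G' : Type) [Group G] [Fintype G] [Group G'] [Fintype G']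
    (E : Rep k G ≌ Rep k G')
    [E.functor.Additive] [E.functor.Linear k] [E.functor.Monoidal] :
    Nonempty (E.functor.obj (Rep.ofMulAction k G G) ≅ Rep.ofMulAction k G' G') := by
  have := Rep.finite_obj_of_isEquivalence E.functor (Rep.leftRegular k G)
  refine Rep.nonempty_iso_of_finrank_hom_eq _ (Rep.leftRegular k G') fun X hX => ?_
  rw [Rep.finrank_hom_obj_leftRegular, (Rep.homLeftRegularEquiv X).finrank_eq,
    Subspace.dual_finrank_eq]
end

section
/- Let k be a field and let G and G' be finite groups. If G and G' are k-isocategorical, i.e., there exists an equivalence of categories E : Rep k G ≌ Rep k G' whose underlying functor is k-linear (additive and k-linear) and monoidal, then Nat.card G = Nat.card G'. -/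
open CategoryTheory

open scoped TensorProduct MonoidAlgebra MonoidalCategory

section RegularRepresentation

universe u

variable {k G : Type u} [Field k]

/-- The `g`-component `k[G] ⊗ V → V`, sending `single h r ⊗ v` to `r • v` if `h = g`
and to `0` otherwise. -/
noncomputable def regularTensorComponent (V : Type u) [AddCommGroup V] [Module k V] (g : G) :
    k[G] ⊗[k] V →ₗ[k] V :=
  TensorProduct.lid k V ∘ₗ
    (Finsupp.lapply g ∘ₗ (MonoidAlgebra.coeffLinearEquiv k).toLinearMap).rTensor V

lemma regularTensorComponent_tmul {V : Type u} [AddCommGroup V] [Module k V] (g : G)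
    (x : k[G]) (v : V) : regularTensorComponent V g (x ⊗ₜ[k] v) = x.coeff g • v := by
  simp [regularTensorComponent]

lemma sum_single_tmul_regularTensorComponent [Fintype G] {V : Type u} [AddCommGroup V]
    [Module k V] (t : k[G] ⊗[k] V) :
    ∑ g : G, MonoidAlgebra.single g (1 : k) ⊗ₜ[k] regularTensorComponent V g t = t := by
  induction t with
  | zero => simp
  | add x y hx hy => simp only [map_add, TensorProduct.tmul_add, Finset.sum_add_distrib, hx, hy]
  | tmul x v =>
    simp only [regularTensorComponent_tmul, ← TensorProduct.smul_tmul, ← TensorProduct.sum_tmul]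
    congr 1
    conv_rhs => rw [← MonoidAlgebra.sum_coeff_single x]
    simp [Finsupp.sum_fintype]

variable [Group G]

lemma regularTensorComponent_tprod {V : Type u} [AddCommGroup V] [Module k V]
    (ρ : Representation k G V) (g h : G) (t : k[G] ⊗[k] V) :
    regularTensorComponent V h ((Representation.leftRegular k G).tprod ρ g t) =
      ρ g (regularTensorComponent V (g⁻¹ * h) t) := by
  induction t with
  | zero => simp
  | add x y hx hy => simp only [map_add, hx, hy]
  | tmul x v =>
    simp [regularTensorComponent_tmul, Representation.coeff_ofMulAction]

/-- Since `k[G] ⊗ V` is coinduced from the vector space `V`, equivariant maps `X ⟶ k[G] ⊗ V`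
are the same as linear maps `X → V`. -/
noncomputable def homRegularTensorEquiv [Fintype G] (X V : Rep.{u} k G) :
    (X ⟶ Rep.leftRegular k G ⊗ V) ≃ₗ[k] (X.V →ₗ[k] V.V) where
  toFun f := regularTensorComponent V.V 1 ∘ₗ f.hom.toLinearMap
  map_add' f g := by rw [Rep.add_hom]; exact LinearMap.comp_add _ _ _
  map_smul' r f := by rw [Rep.smul_hom]; exact LinearMap.comp_smul _ _ _
  invFun φ := Rep.ofHom (σ := (Representation.leftRegular k G).tprod V.ρ)
    ⟨∑ g : G, TensorProduct.mk k k[G] V.V (MonoidAlgebra.single g 1) ∘ₗ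
      V.ρ g ∘ₗ φ ∘ₗ X.ρ g⁻¹, fun h => by
        ext x
        simp only [LinearMap.comp_apply, LinearMap.sum_apply, TensorProduct.mk_apply, map_sum,
          Representation.tprod_apply, TensorProduct.map_tmul,
          Representation.ofMulAction_single, smul_eq_mul]
        refine Fintype.sum_equiv (Equiv.mulLeft h⁻¹) _ _ fun g => ?_
        simp [map_mul]⟩
  left_inv f := by
    ext x
    refine Eq.trans ?_ (sum_single_tmul_regularTensorComponent (f.hom x))
    simp only [Rep.hom_ofHom, Representation.IntertwiningMap.toLinearMap_mk,
      LinearMap.sum_apply, LinearMap.comp_apply, TensorProduct.mk_apply]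
    refine Finset.sum_congr rfl fun g _ => ?_
    have h : f.hom.toLinearMap (X.ρ g⁻¹ x) =
        (Representation.leftRegular k G).tprod V.ρ g⁻¹ (f.hom x) := Rep.hom_comm_apply f g⁻¹ x
    rw [h, regularTensorComponent_tprod]
    simp
  right_inv φ := by
    classical
    ext x
    simp only [Rep.hom_ofHom, Representation.IntertwiningMap.toLinearMap_mk,
      LinearMap.sum_apply, LinearMap.comp_apply, TensorProduct.mk_apply, map_sum,
      regularTensorComponent_tmul, MonoidAlgebra.coeff_single, Finsupp.single_apply]
    simp

/-- Equivariant maps `X ⟶ k[G]` form the linear dual of `X`. -/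
noncomputable def homRegularEquiv [Fintype G] (X : Rep.{u} k G) :
    (X ⟶ Rep.leftRegular k G) ≃ₗ[k] Module.Dual k X.V :=
  Linear.homCongr k (Iso.refl X) (ρ_ (Rep.leftRegular k G)).symm ≪≫ₗ
    homRegularTensorEquiv X (𝟙_ (Rep.{u} k G))

end RegularRepresentation

/-- A fully faithful linear functor induces linear equivalences on spaces of morphisms. -/
noncomputable def CategoryTheory.Functor.homLinearEquivOfFullyFaithful (k : Type*) [Field k]
    {C D : Type*} [Category* C] [Category* D] [Preadditive C] [Preadditive D]
    [CategoryTheory.Linear k C] [CategoryTheory.Linear k D] (F : C ⥤ D) [F.Full] [F.Faithful]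
    [F.Additive] [F.Linear k] (X Y : C) :
    (X ⟶ Y) ≃ₗ[k] (F.obj X ⟶ F.obj Y) :=
  LinearEquiv.ofBijective (F.mapLinearMap k) ⟨F.map_injective, F.map_surjective⟩

/-- Two vector spaces, each of which has the dimension of the dual of the other, are
finite-dimensional of the same dimension. -/
lemma finite_and_finrank_eq_of_dual_equiv {k V W : Type} [Field k] [AddCommGroup V]
    [Module k V] [AddCommGroup W] [Module k W]
    (e : V ≃ₗ[k] Module.Dual k W) (e' : W ≃ₗ[k] Module.Dual k V) :
    Module.Finite k V ∧ Module.finrank k V = Module.finrank k W := by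
  have key : Module.Finite k V := by
    rw [← Module.rank_lt_aleph0_iff]
    by_contra! h
    have h₁ : Module.rank k V < Module.rank k W := by
      rw [e'.rank_eq]; simpa using lift_rank_lt_rank_dual h
    have h₂ : Module.rank k W < Module.rank k V := by
      rw [e.rank_eq]; simpa using lift_rank_lt_rank_dual (h.trans h₁.le)
    exact lt_asymm h₁ h₂
  exact ⟨key, by rw [e'.finrank_eq, Subspace.dual_finrank_eq]⟩

/-- If two finite groups `G` and `G'` are `k`-isocategorical (there is an equivalence of
categories `Rep k G ≌ Rep k G'` whose underlying functor is `k`-linear and monoidal), then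
they have the same cardinality. -/
theorem card_eq_of_isocategorical
    (k : Type) [Field k] (G G' : Type) [Group G] [Fintype G] [Group G'] [Fintype G']
    (E : Rep k G ≌ Rep k G')
    [E.functor.Additive] [E.functor.Linear k] [E.functor.Monoidal] :
    Nat.card G = Nat.card G' := by
  let R := Rep.leftRegular k G
  let R' := Rep.leftRegular k G'
  let S := E.functor.obj R
  let Y := E.inverse.obj R'
  let i : E.functor.obj Y ≅ R' := E.counitIso.app R'
  let F (A B : Rep k G) := E.functor.homLinearEquivOfFullyFaithful k A B
  let μ (A : Rep k G) : E.functor.obj A ⊗ E.functor.obj A ≅ E.functor.obj (A ⊗ A) :=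
    Functor.Monoidal.μIso E.functor A A
  have hS : S.V ≃ₗ[k] Module.Dual k Y.V :=
    (Rep.leftRegularHomEquiv S).symm ≪≫ₗ Linear.homCongr k i.symm (Iso.refl S) ≪≫ₗ
      (F Y R).symm ≪≫ₗ homRegularEquiv Y
  have hY : Y.V ≃ₗ[k] Module.Dual k S.V :=
    (Rep.leftRegularHomEquiv Y).symm ≪≫ₗ F R Y ≪≫ₗ Linear.homCongr k (Iso.refl S) i ≪≫ₗ
      homRegularEquiv S
  obtain ⟨hfin, hdim⟩ := finite_and_finrank_eq_of_dual_equiv hS hY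
  have hSS : (S.V ⊗[k] S.V) ≃ₗ[k] (Y.V →ₗ[k] R.V) :=
    (Rep.leftRegularHomEquiv (S ⊗ S)).symm ≪≫ₗ Linear.homCongr k i.symm (μ R) ≪≫ₗ
      (F Y (R ⊗ R)).symm ≪≫ₗ homRegularTensorEquiv Y R
  have hYY : (Y.V ⊗[k] Y.V) ≃ₗ[k] (S.V →ₗ[k] R'.V) :=
    (Rep.leftRegularHomEquiv (Y ⊗ Y)).symm ≪≫ₗ F R (Y ⊗ Y) ≪≫ₗ
      Linear.homCongr k (Iso.refl S) ((μ Y).symm ≪≫ (i ⊗ᵢ i)) ≪≫ₗ homRegularTensorEquiv S R'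
  have hYfin : Module.Finite k Y.V := Module.Finite.equiv hY.symm
  have hR : Module.finrank k R.V = Nat.card G := by
    rw [Nat.card_eq_fintype_card]
    exact (MonoidAlgebra.coeffLinearEquiv k).finrank_eq.trans (Module.finrank_finsupp_self k)
  have hR' : Module.finrank k R'.V = Nat.card G' := by
    rw [Nat.card_eq_fintype_card]
    exact (MonoidAlgebra.coeffLinearEquiv k).finrank_eq.trans (Module.finrank_finsupp_self k)
  have hpos : 0 < Module.finrank k S.V := by
    rw [Module.finrank_pos_iff, ← not_subsingleton_iff_nontrivial, ← Rep.isZero_iff]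
    intro h
    have h₁ : Limits.IsZero R := by
      rw [Limits.IsZero.iff_id_eq_zero]
      exact E.functor.map_injective (h.eq_of_src _ _)
    rw [Rep.isZero_iff] at h₁
    exact absurd hR (by rw [Module.finrank_zero_of_subsingleton]; exact Nat.card_pos.ne)
  have h₁ := hSS.finrank_eq
  have h₂ := hYY.finrank_eq
  rw [Module.finrank_tensorProduct, Module.finrank_linearMap, hR, ← hdim] at h₁
  rw [Module.finrank_tensorProduct, Module.finrank_linearMap, hR', ← hdim] at h₂
  exact Nat.eq_of_mul_eq_mul_left hpos (h₁.symm.trans h₂)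
end

section
/- Let G₁ = Q₈ × C₂ be the direct product of the quaternion group of order 8 with the cyclic group of order 2, and let G₂ be the semidirect product of a cyclic group of order 4 by a cyclic group of order 4 in which the acting generator acts by inversion (i.e., G₂ = ⟨x, y | x⁴ = y⁴ = 1, y x y⁻¹ = x⁻¹⟩). Then Nat.card (QuaternionGroup 2 →* G₁) = 112 and Nat.card (QuaternionGroup 2 →* G₂) = 16. -/
/-- The homomorphism from `Multiplicative (ZMod n)` to a group `G` sending the generator to
an element `g` with `g ^ n = 1`. -/
def cyclicHom (n : ℕ) [NeZero n] {G : Type*} [Group G] (g : G) (hg : g ^ n = 1) :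
    Multiplicative (ZMod n) →* G where
  toFun a := g ^ (a.toAdd.val)
  map_one' := by simp
  map_mul' x y := by
    have key : ∀ m : ℕ, g ^ (m % n) = g ^ m := fun m => by
      conv_rhs => rw [← Nat.mod_add_div m n, pow_add, pow_mul, hg, one_pow, mul_one]
    show g ^ ((x.toAdd + y.toAdd).val) = _
    rw [ZMod.val_add, key, pow_add]

/-- The inversion automorphism of `Multiplicative (ZMod 4)`. -/
def invAut : MulAut (Multiplicative (ZMod 4)) := MulEquiv.inv (Multiplicative (ZMod 4))

lemma invAut_pow_four : invAut ^ 4 = 1 := by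
  have h2 : invAut ^ 2 = 1 := by
    ext x
    simp [invAut, sq]
  have h4 : invAut ^ 4 = (invAut ^ 2) ^ 2 := by rw [← pow_mul]
  rw [h4, h2, one_pow]

/-- The action of `Multiplicative (ZMod 4)` on itself in which the generator acts by
inversion. -/
def φ : Multiplicative (ZMod 4) →* MulAut (Multiplicative (ZMod 4)) :=
  cyclicHom 4 invAut invAut_pow_four

/-- `G₂ = ⟨x, y | x⁴ = y⁴ = 1, y x y⁻¹ = x⁻¹⟩`. -/
abbrev G₂ := SemidirectProduct (Multiplicative (ZMod 4)) (Multiplicative (ZMod 4)) φ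

/-- `G₁ = Q₈ × C₂`. -/
abbrev G₁ := QuaternionGroup 2 × Multiplicative (ZMod 2)

namespace QuaternionGroup

variable {n : ℕ} {G : Type*} [Group G]

/-- Two elements of a group satisfy the defining relations of `QuaternionGroup n`. The relation
`g ^ (2 * n) = 1` is a consequence of these two, see `IsGenPair.pow_two_mul`. -/
def IsGenPair (n : ℕ) (p : G × G) : Prop :=
  p.2 * p.2 = p.1 ^ n ∧ p.1 * p.2 * p.1 = p.2

instance [DecidableEq G] (p : G × G) : Decidable (IsGenPair n p) :=
  inferInstanceAs (Decidable (_ ∧ _))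

namespace IsGenPair

variable {p : G × G}

lemma semiconjBy (hp : IsGenPair n p) : SemiconjBy p.2 p.1 p.1⁻¹ := by
  rw [SemiconjBy, eq_inv_mul_iff_mul_eq, ← mul_assoc]
  exact hp.2

lemma pow_two_mul (hp : IsGenPair n p) : p.1 ^ (2 * n) = 1 := by
  have h : SemiconjBy p.2 (p.1 ^ n) (p.1 ^ n) := by
    rw [← hp.1]
    exact (Commute.refl p.2).mul_right (Commute.refl p.2)
  have h' := hp.semiconjBy.pow_right n
  have key : p.1 ^ n * p.2 = p.1⁻¹ ^ n * p.2 := h.eq.symm.trans h'.eq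
  have key' := mul_right_cancel key
  rw [inv_pow, eq_inv_iff_mul_eq_one, ← pow_add, ← two_mul] at key'
  exact key'

/-- The homomorphism `i ↦ p.1 ^ i` from the cyclic group of order `2 * n`. -/
def powHom (hp : IsGenPair n p) : ZMod (2 * n) →+ Additive G :=
  ZMod.lift (2 * n) ⟨zmultiplesHom (Additive G) (Additive.ofMul p.1), by
    have h : Additive.ofMul (p.1 ^ (2 * n)) = 0 := by rw [hp.pow_two_mul]; rfl
    rw [zmultiplesHom_apply, natCast_zsmul]
    exact h⟩

lemma powHom_intCast (hp : IsGenPair n p) (k : ℤ) : (hp.powHom k).toMul = p.1 ^ k := by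
  simp [powHom]

/-- The homomorphism from `QuaternionGroup n` sending `a 1` and `xa 0` to the components of `p`. -/
def lift (hp : IsGenPair n p) : QuaternionGroup n →* G :=
  MonoidHom.mk'
    (fun
      | a i => (hp.powHom i).toMul
      | xa i => p.2 * (hp.powHom i).toMul) <| by
    have key (k : ℤ) : p.1 ^ k * p.2 = p.2 * p.1 ^ (-k) := by
      simpa using (hp.semiconjBy.zpow_right (-k)).eq.symm
    have hn (k : ℤ) : p.2 * (p.2 * p.1 ^ k) = p.1 ^ (n + k) := by
      rw [← mul_assoc, hp.1, zpow_add, zpow_natCast]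
    rintro (i | i) (j | j) <;>
      obtain ⟨i, rfl⟩ := ZMod.intCast_surjective i <;>
      obtain ⟨j, rfl⟩ := ZMod.intCast_surjective j
    · simp only [a_mul_a, ← Int.cast_add, powHom_intCast, zpow_add]
    · simp only [a_mul_xa, ← Int.cast_sub, powHom_intCast]
      rw [← mul_assoc, key, mul_assoc, ← zpow_add, neg_add_eq_sub]
    · simp only [xa_mul_a, ← Int.cast_add, powHom_intCast, zpow_add, mul_assoc]
    · simp only [xa_mul_xa, ← Int.cast_natCast (R := ZMod (2 * n)) n, ← Int.cast_add,
        ← Int.cast_sub, powHom_intCast]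
      rw [mul_assoc, ← mul_assoc (p.1 ^ i), key, mul_assoc, ← zpow_add, hn]
      congr 1
      ring

end IsGenPair

lemma a_one_zpow (k : ℤ) : (a 1 : QuaternionGroup n) ^ k = a k := by
  obtain ⟨k, rfl | rfl⟩ := k.eq_nat_or_neg
  · rw [zpow_natCast, a_one_pow, Int.cast_natCast]
  · rw [zpow_neg, zpow_natCast, a_one_pow, Int.cast_neg, Int.cast_natCast]
    rfl

lemma isGenPair_map (f : QuaternionGroup n →* G) : IsGenPair n (f (a 1), f (xa 0)) := by
  constructor
  · simp only [← map_mul, ← map_pow, a_one_pow, xa_mul_xa, add_zero, sub_zero]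
  · simp only [← map_mul, a_mul_xa, xa_mul_a, sub_add_cancel]

/-- Homomorphisms from `QuaternionGroup n` correspond to pairs satisfying its relations. -/
def homEquiv : (QuaternionGroup n →* G) ≃ {p : G × G // IsGenPair n p} where
  toFun f := ⟨(f (a 1), f (xa 0)), isGenPair_map f⟩
  invFun p := p.2.lift
  left_inv f := by
    have h (i : ℤ) : ((isGenPair_map f).powHom i).toMul = f (a i) := by
      rw [IsGenPair.powHom_intCast, ← map_zpow]
      exact congrArg f (a_one_zpow i)
    ext (i | i) <;> obtain ⟨i, rfl⟩ := ZMod.intCast_surjective i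
    · exact h i
    · refine (congrArg (f (xa 0) * ·) (h i)).trans ?_
      simp only [← map_mul, xa_mul_a, zero_add]
  right_inv p := by
    ext
    · show (p.2.powHom 1).toMul = p.1.1
      simpa using p.2.powHom_intCast 1
    · show p.1.2 * (p.2.powHom 0).toMul = p.1.2
      simp

end QuaternionGroup

instance : Fintype G₂ :=
  Fintype.ofEquiv _ (SemidirectProduct.equivProd (φ := φ)).symm

/-- The number of group homomorphisms from `Q₈` to `G₁ = Q₈ × C₂` is `112`, while the number
of group homomorphisms from `Q₈` to `G₂ = ⟨x, y | x⁴ = y⁴ = 1, y x y⁻¹ = x⁻¹⟩` is `16`. -/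
theorem card_hom_quaternionGroup_G₁_G₂ :
    Nat.card (QuaternionGroup 2 →* G₁) = 112 ∧
      Nat.card (QuaternionGroup 2 →* G₂) = 16 := by
  rw [Nat.card_congr (QuaternionGroup.homEquiv (G := G₁)),
    Nat.card_congr (QuaternionGroup.homEquiv (G := G₂)),
    Nat.card_eq_fintype_card, Nat.card_eq_fintype_card]
  constructor <;> decide +kernel
end
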